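/- Under the standing hypotheses, for all h, h' ∈ H and all nonzero x ∈ D_h and y ∈ D_{h'} which commute with every element of D_e: the commutator c = x y x⁻¹ y⁻¹ lies in L and satisfies c^{n_H} = 1, where n_H is the exponent of H; c depends only on the pair (h, h') and not on the choices of x and y; and c is G-invariant, i.e., for every g ∈ G and all nonzero x' ∈ D_{g h g⁻¹} and y' ∈ D_{g h' g⁻¹} commuting with every element of D_e, one has x' y' x'⁻¹ y'⁻¹ = c. -/

import Mathlib

variable {G : Type*} [Group G] [DecidableEq G] {D : Type*} [DivisionRing D]

/-- A faithful `G`-grading on `D`: a family of additive subgroups forming an internal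
direct sum decomposition, multiplicative, with all components nonzero. -/
structure IsFaithfulGrading (𝒜 : G → AddSubgroup D) : Prop where
  one_mem : (1 : D) ∈ 𝒜 1
  mul_mem : ∀ {g h : G} {x y : D}, x ∈ 𝒜 g → y ∈ 𝒜 h → x * y ∈ 𝒜 (g * h)
  isInternal : DirectSum.IsInternal 𝒜
  faithful : ∀ g, 𝒜 g ≠ ⊥

/-- `L`, the center of the identity component `D_e`, as a set. -/
def Lset (𝒜 : G → AddSubgroup D) : Set D := {x | x ∈ 𝒜 1 ∧ ∀ y ∈ 𝒜 1, x * y = y * x}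

/-- The kernel of the conjugation action of `G` on `L`, as a set:
`{g ∈ G : x·l = l·x for every x ∈ D_g and every l ∈ L}`. -/
def Hset (𝒜 : G → AddSubgroup D) : Set G := {g | ∀ x ∈ 𝒜 g, ∀ l ∈ Lset 𝒜, x * l = l * x}

open scoped commutatorElement

theorem perfect_aux {H : Type*} [Group H] [Finite H]
    (hp : ∀ K : Subgroup H, K ≠ ⊤ → ∀ a ∈ K, ∀ b ∈ K, Commute a b)
    (hne : ¬ ∀ a b : H, Commute a b) : commutator H ≠ ⊤ := by
  intro hcomm
  have hntriv : Nontrivial H := by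
    by_contra h
    rw [not_nontrivial_iff_subsingleton] at h
    exact hne fun a b => Subsingleton.elim _ _
  have hns : ¬ Group.IsSolvable H := by
    intro hs
    exact (Group.IsSolvable.commutator_lt_top_of_nontrivial H).ne hcomm
  apply hns
  have : Group.IsNilpotent H := by
    refine ((Group.isNilpotent_of_finite_tfae (G := H)).out 0 3 rfl rfl).mpr ?_
    intro p hpp P
    by_cases hN : Subgroup.normalizer (P : Set H) = ⊤
    · exact Subgroup.normalizer_eq_top_iff.mp hN
    exfalso
    have hle : Subgroup.normalizer (P : Set H) ≤ Subgroup.centralizer (P : Set H) := by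
      intro g hg
      rw [Subgroup.mem_centralizer_iff]
      intro k hk
      exact hp _ hN k (Subgroup.le_normalizer hk) g hg
    have hc := MonoidHom.ker_transferSylow_isComplement' P hle
    have hker : (MonoidHom.transferSylow P hle).ker = ⊤ := by
      rw [eq_top_iff, ← hcomm, commutator_def, Subgroup.commutator_le]
      intro a _ b _
      have : IsMulCommutative P := ⟨⟨fun a b => Subtype.ext (hle (Subgroup.le_normalizer b.2) a a.2)⟩⟩
      rw [MonoidHom.mem_ker, map_commutatorElement]
      rw [commutatorElement_eq_one_iff_commute]
      exact mul_comm' _ _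
    rw [hker] at hc
    have hbot : (P : Subgroup H) = ⊥ := by
      have := hc.disjoint
      simpa using this
    apply hN
    have hnorm : (P : Subgroup H).Normal := by rw [hbot]; infer_instance
    exact Subgroup.normalizer_eq_top_iff.mpr hnorm
  infer_instance

theorem ab_of_X.{u} : ∀ (k : ℕ) {H : Type u} [Group H] [Finite H], Nat.card H = k →
    (∀ u y : H, (∀ i : ℕ, Commute u (y ^ i * u * (y ^ i)⁻¹)) → Commute u y) → 
    ∀ a b : H, Commute a b := by
  intro k
  induction k using Nat.strong_induction_on with
  | _ k ih =>
  intro H _ _ hk X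
  by_contra hne
  have hp : ∀ K : Subgroup H, K ≠ ⊤ → ∀ a ∈ K, ∀ b ∈ K, Commute a b := by
    intro K hK a ha b hb
    have hlt : Nat.card K < k := by
      rw [← hk]
      refine lt_of_le_of_ne (Subgroup.card_le_card_group K) fun h => hK (Subgroup.eq_top_of_card_eq K h)
    have := ih _ hlt (H := K) rfl (by
      intro u y h
      have := X u y (fun i => by
        have := congrArg Subtype.val (h i).eq
        simpa [Commute, SemiconjBy] using this)
      exact Subtype.ext this) ⟨a, ha⟩ ⟨b, hb⟩
    exact congrArg Subtype.val this.eq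
  have hct := perfect_aux hp hne
  have hN := hp _ hct
  have hcen : ∀ u ∈ commutator H, ∀ y, Commute u y := by
    intro u hu y
    refine X u y fun i => hN u hu _ ?_
    exact (inferInstance : (commutator H).Normal).conj_mem u hu _
  apply hne
  intro a b
  refine X a b fun i => ?_
  have h1 : ⁅b ^ i, a⁆ ∈ commutator H := Subgroup.commutator_mem_commutator (Subgroup.mem_top _) (Subgroup.mem_top _)
  have h2 := hcen _ h1 a
  have : b ^ i * a * (b ^ i)⁻¹ = ⁅b ^ i, a⁆ * a := by rw [commutatorElement_def]; group
  rw [this]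
  exact h2.symm.mul_right (Commute.refl a)

/-- Homogeneous units commuting with the identity component. -/
structure PairSys {G D : Type*} [Group G] [DivisionRing D]
    (S : G → Dˣ → Prop) (H : Subgroup G) (n : ℕ) : Prop where
  one : S 1 1
  mul : ∀ {g h : G} {x y : Dˣ}, S g x → S h y → S (g * h) (x * y)
  inv : ∀ {g : G} {x : Dˣ}, S g x → S g⁻¹ x⁻¹
  inj : ∀ {g h : G} {x : Dˣ}, S g x → S h x → g = h
  neg : S 1 (-1)
  comm : ∀ {h : G} {l x : Dˣ}, h ∈ H → S 1 l → S h x → Commute l x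
  ex : ∀ {h : G}, h ∈ H → ∃ x, S h x
  root : ∀ {x : Dˣ}, x ^ n = 1 → S 1 x ∧ ∀ y, Commute x y
  exp : ∀ g : G, g ^ n = 1

theorem odd_two_eq_one {G : Type*} [Group G] {g : G} {m : ℕ} (hm : Odd m)
    (h2 : g ^ 2 = 1) (h : g ^ m = 1) : g = 1 := by
  obtain ⟨k, rfl⟩ := hm
  rw [pow_succ, pow_mul, h2, one_pow, one_mul] at h
  exact h

theorem pow_swap {G : Type*} [Group G] {x c w : G} (h : x * c = w * c * x)
    (hx : Commute w x) (k : ℕ) : x ^ k * c = w ^ k * c * x ^ k := by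
  induction k with
  | zero => simp
  | succ k ih =>
    rw [pow_succ, mul_assoc, h]
    have : x ^ k * (w * c * x) = w * (x ^ k * c) * x := by
      have h1 := (hx.pow_right k).eq
      simp only [← mul_assoc]
      rw [← h1]
    rw [this, ih, pow_succ']
    simp only [mul_assoc]

theorem mul_pow_swap {G : Type*} [Group G] {x c w : G} (h : x * c = w * c * x)
    (hx : Commute w x) (hc : Commute w c) (k : ℕ) :
    (c * x) ^ k = w ^ (k.choose 2) * c ^ k * x ^ k := by
  induction k with
  | zero => simp
  | succ k ih =>
    rw [pow_succ, ih]
    have h1 := pow_swap h hx k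
    have h2 := (hc.pow_pow k k).eq
    have : (k + 1).choose 2 = k.choose 2 + k := by
      rw [Nat.choose_succ_succ' k 1]; simp [add_comm]
    rw [this, pow_add, pow_succ x, pow_succ c]
    calc w ^ k.choose 2 * c ^ k * x ^ k * (c * x)
        = w ^ k.choose 2 * c ^ k * (x ^ k * c) * x := by group
      _ = w ^ k.choose 2 * (c ^ k * w ^ k) * c * x ^ k * x := by rw [h1]; simp only [mul_assoc]
      _ = _ := by rw [← h2]; simp only [mul_assoc]

theorem cop_commute {G : Type*} [Group G] {z u : G} {k m : ℕ} (h : Commute (z ^ k) u)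
    (hm : z ^ m = 1) (hk : Nat.Coprime k m) : Commute z u := by
  obtain ⟨j, hj⟩ := exists_pow_eq_self_of_coprime
    (Nat.Coprime.coprime_dvd_right (orderOf_dvd_of_pow_eq_one hm) hk)
  rw [← hj]
  exact h.pow_left j

theorem units_pm {D : Type*} [DivisionRing D] {z : Dˣ} (h : z ^ 2 = 1) : z = 1 ∨ z = -1 := by
  have h1 : ((z : D) - 1) * ((z : D) + 1) = 0 := by
    have : (z : D) ^ 2 = 1 := by rw [← Units.val_pow_eq_pow_val, h]; simp
    have h3 : ((z : D) - 1) * ((z : D) + 1) = (z : D) ^ 2 - 1 := by noncomm_ring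
    rw [h3, this, sub_self]
  rcases mul_eq_zero.mp h1 with h | h
  · left; ext; simpa [sub_eq_zero] using h
  · right; ext; simpa [add_eq_zero_iff_eq_neg] using h

theorem quat_aux {D : Type*} [DivisionRing D] [CharZero D] {i j : Dˣ} {n : ℕ}
    (hi : i * i = -1) (hj : j * j = -1) (hij : j * i = -(i * j)) (h3 : 3 ∣ n)
    (root : ∀ {x : Dˣ}, x ^ n = 1 → ∀ y, Commute x y) : False := by
  have hi' : (i : D) * i = -1 := by simpa using congrArg Units.val hi
  have hj' : (j : D) * j = -1 := by simpa using congrArg Units.val hj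
  have hij' : (j : D) * i = -((i : D) * j) := by simpa using congrArg Units.val hij
  have h2 : (2 : D) ≠ 0 := two_ne_zero
  have h4 : (4 : D) ≠ 0 := by norm_num
  obtain ⟨i, i', e1, e2⟩ := i
  obtain ⟨j, j', e3, e4⟩ := j
  simp only at hi' hj' hij'
  have a1 : j * i * i = -j := by rw [mul_assoc, hi']; simp
  have a2 : i * j * j = -i := by rw [mul_assoc, hj']; simp
  have a3 : i * j * i = j := by rw [mul_assoc, hij', mul_neg, ← mul_assoc, hi']; simp
  have a4 : i * (i * j) = -j := by rw [← mul_assoc, hi']; simp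
  have a5 : j * (i * j) = i := by rw [← mul_assoc, hij', neg_mul, a2]; simp
  have a6 : i * j * (i * j) = -1 := by rw [← mul_assoc, a3, hj']
  have hq : (i + j + i * j) * (i + j + i * j) = -3 := by
    have : (i + j + i * j) * (i + j + i * j) = i * i + i * j + i * (i * j) + j * i + j * j
      + j * (i * j) + i * j * i + i * j * j + i * j * (i * j) := by noncomm_ring
    rw [this, hi', a4, hij', hj', a5, a3, a2, a6]
    have : (3 : D) = 1 + 1 + 1 := by norm_num
    rw [this]
    abel
  obtain ⟨w, hw⟩ : ∃ w : D, 2 * w = -1 + (i + j + i * j) :=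
    ⟨2⁻¹ * (-1 + (i + j + i * j)), by rw [← mul_assoc, mul_inv_cancel₀ h2, one_mul]⟩
  have hw2 : w * w + w + 1 = 0 := by
    have : 4 * (w * w + w + 1) = (2 * w) * (2 * w) + 2 * (2 * w) + 4 := by
      have h44 : (4 : D) = 1 + 1 + 1 + 1 := by norm_num
      rw [h44]; noncomm_ring
    rw [hw] at this
    have h5 : (-1 + (i + j + i * j)) * (-1 + (i + j + i * j)) + 2 * (-1 + (i + j + i * j)) + 4
      = (i + j + i * j) * (i + j + i * j) + 3 := by
      have h44 : (4 : D) = 1 + 1 + 1 + 1 := by norm_num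
      have h33 : (3 : D) = 1 + 1 + 1 := by norm_num
      rw [h44, h33]; noncomm_ring
    rw [h5, hq, neg_add_cancel] at this
    exact (mul_eq_zero.mp this).resolve_left h4
  have hw3 : w ^ 3 = 1 := by
    have : w ^ 3 - 1 = (w - 1) * (w * w + w + 1) := by noncomm_ring
    rw [hw2, mul_zero, sub_eq_zero] at this
    exact this
  have hw0 : w ≠ 0 := by rintro rfl; simp at hw2
  have hwn : (Units.mk0 w hw0) ^ n = 1 := by
    obtain ⟨k, rfl⟩ := h3
    ext
    simp [pow_mul, hw3]
  have hc : w * i = i * w := by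
    have := root hwn ⟨i, i', e1, e2⟩
    simpa using congrArg Units.val this.eq
  have h6 : (2 * w) * i = i * (2 * w) := by
    have : i * (2 * w) = 2 * (i * w) := by noncomm_ring
    rw [this, mul_assoc, hc]
  rw [hw] at h6
  have h7 : (-1 + (i + j + i * j)) * i = -i + i * i + j * i + i * j * i := by noncomm_ring
  have h8 : i * (-1 + (i + j + i * j)) = -i + i * i + i * j + i * (i * j) := by noncomm_ring
  rw [h7, h8, hij', a3, a4] at h6
  have h9 : 2 * (j - i * j) = 0 := by
    have : 2 * (j - i * j) = (-i + i * i + -(i * j) + j) - (-i + i * i + i * j + -j) := by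
      noncomm_ring
    rw [this, h6, sub_self]
  have h10 : j = i * j := by
    rcases mul_eq_zero.mp h9 with h | h
    · exact absurd h h2
    · exact sub_eq_zero.mp h
  have h11 : i = 1 := by
    have : (i - 1) * j = 0 := by rw [sub_mul, ← h10, one_mul, sub_self]
    rcases mul_eq_zero.mp this with h | h
    · exact sub_eq_zero.mp h
    · rw [h] at e3; simp at e3
  rw [h11] at hi'
  have : (2 : D) = 0 := by
    have : (2 : D) = 1 * 1 + 1 := by norm_num
    rw [this, hi']; simp
  exact h2 this

namespace PairSys

variable {G D : Type*} [Group G] [DivisionRing D] {S : G → Dˣ → Prop} {H : Subgroup G} {n : ℕ}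

theorem pow (P : PairSys S H n) {g : G} {x : Dˣ} (h : S g x) (k : ℕ) : S (g ^ k) (x ^ k) := by
  induction k with
  | zero => simpa using P.one
  | succ k ih => rw [pow_succ, pow_succ]; exact P.mul ih h

theorem conj (P : PairSys S H n) {g h : G} {x y : Dˣ} (hy : S g y) (hx : S h x) :
    S (g * h * g⁻¹) (y * x * y⁻¹) := P.mul (P.mul hy hx) (P.inv hy)

theorem pm (P : PairSys S H n) {z : Dˣ} (h : z ^ 2 = 1) : S 1 z := by
  rcases units_pm h with rfl | rfl
  · exact P.one
  · exact P.neg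

theorem lemA (P : PairSys S H n) {u y : G} (hu : u ∈ H) (hy : y ∈ H)
    (hc : Commute u (y * u * y⁻¹)) :
    Commute u y ∨ (n % 4 = 2 ∧ (y * u * y⁻¹ * u⁻¹) ^ 2 = 1) := by
  obtain ⟨x, hx⟩ := P.ex hu
  obtain ⟨Y, hY⟩ := P.ex hy
  set v := y * u * y⁻¹ * u⁻¹ with hv
  have hvH : v ∈ H := H.mul_mem (H.mul_mem (H.mul_mem hy hu) (H.inv_mem hy)) (H.inv_mem hu)
  have huv : Commute u v := hc.mul_right (Commute.refl u).inv_right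
  set c := Y * x * Y⁻¹ * x⁻¹ with hcdef
  have hcS : S v c := P.mul (P.conj hY hx) (P.inv hx)
  obtain ⟨w, hw⟩ : ∃ w, w = x * c * x⁻¹ * c⁻¹ := ⟨_, rfl⟩
  have hwS : S 1 w := by
    have := P.mul (P.mul (P.mul hx hcS) (P.inv hx)) (P.inv hcS)
    rw [← hw] at this
    convert this using 1
    rw [huv.eq]; group
  have hwx := P.comm hu hwS hx
  have hwc := P.comm hvH hwS hcS
  have hxc : x * c = w * c * x := by rw [hw]; group
  have hxn : S 1 (x ^ n) := by simpa [P.exp] using P.pow hx n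
  have hcx : (c * x) ^ n = x ^ n := by
    have h1 : c * x = Y * x * Y⁻¹ := by rw [hcdef]; group
    rw [h1, conj_pow, ← (P.comm hy hxn hY).eq]; group
  have h1 := mul_pow_swap hxc hwx hwc n
  rw [hcx] at h1
  have h2 : w ^ (n.choose 2) * c ^ n = 1 := by
    have := h1.symm
    rwa [mul_eq_right] at this
  have hwn : w ^ n = 1 := by
    have h3 := pow_swap hxc hwx n
    rw [(P.comm hvH hxn hcS).eq] at h3
    have := mul_right_cancel h3
    exact (mul_eq_right.mp this.symm)
  have hc2 : (c ^ 2) ^ n = 1 := by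
    have h3 : w ^ (n.choose 2 * 2) = 1 := by
      rw [Nat.choose_two_right, Nat.div_mul_cancel (Nat.even_mul_pred_self n).two_dvd, pow_mul, hwn, one_pow]
    have h4 : c ^ n = (w ^ (n.choose 2))⁻¹ := eq_inv_of_mul_eq_one_right h2
    rw [← pow_mul, mul_comm, pow_mul, h4, inv_pow, ← pow_mul, h3, inv_one]
  obtain ⟨r1, r2⟩ := P.root hc2
  have hv2 : v ^ 2 = 1 := P.inj (P.pow hcS 2) r1
  have hw2 : w ^ 2 = 1 := by
    have h3 : x * c ^ 2 * x⁻¹ = w ^ 2 * c ^ 2 := by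
      rw [← conj_pow, ← hwc.mul_pow]
      congr 1
      rw [hxc]; group
    rw [← (r2 x).eq, mul_inv_cancel_right] at h3
    exact mul_eq_right.mp h3.symm
  by_cases hn : n % 4 = 2
  · exact Or.inr ⟨hn, hv2⟩
  left
  have hw' : w ^ (n.choose 2) = 1 := by
    rcases Nat.even_or_odd n with he | ho
    · obtain ⟨k, hk⟩ : ∃ k, n = 4 * k := ⟨n / 4, by
        have := Nat.even_iff.mp he
        omega⟩
      have : n.choose 2 = 2 * (k * (n - 1)) := by
        rw [Nat.choose_two_right]
        refine Nat.div_eq_of_eq_mul_right two_pos ?_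
        obtain ⟨b, hb⟩ : ∃ b, b = n - 1 := ⟨_, rfl⟩
        rw [← hb, hk]
        ring
      rw [this, pow_mul, hw2, one_pow]
    · rw [odd_two_eq_one ho hw2 hwn, one_pow]
  rw [hw', one_mul] at h2
  have hv1 : v = 1 := P.inj hcS (P.root h2).1
  rw [hv, mul_inv_eq_one, mul_inv_eq_iff_eq_mul] at hv1
  exact hv1.symm

theorem lemB [CharZero D] (P : PairSys S H n) {u z : G} {m : ℕ} (hu : u ∈ H) (hz : z ∈ H)
    (hu2 : u ^ 2 = 1) (hm : Odd m) (hmn : m ∣ n) (hzm : z ^ m = 1)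
    (hc : ∀ i : ℕ, Commute u (z ^ i * u * (z ^ i)⁻¹)) : Commute z u := by
  obtain ⟨x, hx⟩ := P.ex hu
  obtain ⟨Z, hZ⟩ := P.ex hz
  by_contra hne
  obtain ⟨a, ha⟩ : ∃ a, a = x ^ 2 := ⟨_, rfl⟩
  have haS : S 1 a := by rw [ha, ← hu2]; exact P.pow hx 2
  obtain ⟨U, hU⟩ : ∃ U : ℕ → G, ∀ i, U i = z ^ i * u * (z ^ i)⁻¹ := ⟨_, fun _ => rfl⟩
  obtain ⟨X, hX⟩ : ∃ X : ℕ → Dˣ, ∀ i, X i = Z ^ i * x * (Z ^ i)⁻¹ := ⟨_, fun _ => rfl⟩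
  have hUH : ∀ i, U i ∈ H := fun i => by
    rw [hU]
    exact H.mul_mem (H.mul_mem (H.pow_mem hz _) hu) (H.inv_mem (H.pow_mem hz _))
  have hS : ∀ i, S (U i) (X i) := fun i => by rw [hU, hX]; exact P.conj (P.pow hZ i) hx
  have hX2 : ∀ i, X i * X i = a := fun i => by
    rw [← pow_two, hX, conj_pow, ← ha, ← (P.comm (H.pow_mem hz i) haS (P.pow hZ i)).eq]
    group
  have haX : ∀ i, Commute a (X i) := fun i => P.comm (hUH i) haS (hS i)
  have hUd : ∀ i k, U i = U (i + k) → Commute (z ^ k) u := by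
    intro i k h
    rw [hU, hU, pow_add] at h
    have h2 : u = z ^ k * u * (z ^ k)⁻¹ := by
      have : (z ^ i)⁻¹ * (z ^ i * u * (z ^ i)⁻¹) * z ^ i
        = (z ^ i)⁻¹ * (z ^ i * z ^ k * u * (z ^ i * z ^ k)⁻¹) * z ^ i := by rw [h]
      calc u = (z ^ i)⁻¹ * (z ^ i * u * (z ^ i)⁻¹) * z ^ i := by group
        _ = _ := this
        _ = _ := by simp only [mul_inv_rev, mul_assoc, inv_mul_cancel, inv_mul_cancel_left, mul_one]
    rw [eq_mul_inv_iff_mul_eq] at h2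
    exact h2.symm
  have hUc : ∀ i k, Commute (U i) (U (i + k)) := by
    intro i k
    have h1 := (hc k).eq
    rw [hU, hU, pow_add]
    have : z ^ i * z ^ k * u * (z ^ i * z ^ k)⁻¹ = z ^ i * (z ^ k * u * (z ^ k)⁻¹) * (z ^ i)⁻¹ := by
      simp only [mul_inv_rev, mul_assoc]
    rw [this]
    show _ * _ = _ * _
    rw [conj_mul, conj_mul, h1]
  have hanti : ∀ i k, ¬ Commute (z ^ k) u → X (i + k) * X i = -(X i * X (i + k)) := by
    intro i k hk
    obtain ⟨w, hw⟩ : ∃ w, w = X i * X (i + k) * (X i)⁻¹ * (X (i + k))⁻¹ := ⟨_, rfl⟩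
    have hwS : S 1 w := by
      have := P.mul (P.mul (P.mul (hS i) (hS (i + k))) (P.inv (hS i))) (P.inv (hS (i + k)))
      rw [← hw] at this
      convert this using 1
      rw [(hUc i k).eq]; group
    have hwX := P.comm (hUH i) hwS (hS i)
    have hsw : X i * X (i + k) = w * X (i + k) * X i := by rw [hw]; group
    have h2 := pow_swap hsw hwX 2
    have h3 : w ^ 2 = 1 := by
      rw [pow_two (X i), hX2, (haX (i + k)).eq] at h2
      have := mul_right_cancel h2
      exact (mul_eq_right.mp this.symm)
    rcases units_pm h3 with h | h
    · exfalso
      apply hk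
      apply hUd i k
      rw [h, one_mul] at hsw
      have h4 : (X i * (X (i + k))⁻¹) ^ 2 = 1 := by
        have h5 : Commute (X i) (X (i + k)) := hsw
        rw [h5.inv_right.mul_pow, inv_pow, pow_two, pow_two, hX2, hX2, mul_inv_cancel]
      have h6 := P.inj (P.mul (hS i) (P.inv (hS (i + k)))) (P.pm h4)
      exact mul_inv_eq_one.mp h6
    · rw [hsw, h]; simp
  have n1 : ¬ Commute (z ^ 1) u := by simpa using hne
  have n2 : ¬ Commute (z ^ 2) u := fun h =>
    hne (cop_commute h hzm (Nat.coprime_two_left.mpr hm))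
  have n4 : ¬ Commute (z ^ 4) u := fun h =>
    hne (cop_commute h hzm (by
      have : Nat.Coprime (2 ^ 2) m := Nat.Coprime.pow_left 2 (Nat.coprime_two_left.mpr hm)
      exact this))
  by_cases h3 : Commute (z ^ 3) u
  · have h3m : 3 ∣ m := by
      by_contra h
      exact hne (cop_commute h3 hzm ((Nat.Prime.coprime_iff_not_dvd Nat.prime_three).mpr h))
    have a01 := hanti 0 1 n1
    have a12 := hanti 1 1 n1
    have a02 := hanti 0 2 n2
    norm_num at a01 a12 a02
    have s0 := hX2 0
    have s1 := hX2 1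
    have s2 := hX2 2
    have c0 := (haX 0).inv_left
    have c1 := (haX 1).inv_left
    have c2 := (haX 2).inv_left
    generalize X 0 = p at *
    generalize X 1 = q at *
    generalize X 2 = r at *
    have e1 : p * q * (p * q) = -(a * a) := by
      rw [mul_assoc, ← mul_assoc q, a01, neg_mul, mul_neg, mul_assoc p q q, s1, ← mul_assoc, s0]
    have e2 : q * r * (q * r) = -(a * a) := by
      rw [mul_assoc, ← mul_assoc r, a12, neg_mul, mul_neg, mul_assoc q r r, s2, ← mul_assoc, s1]
    have cpq : Commute a⁻¹ (p * q) := c0.mul_right c1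
    have cqr : Commute a⁻¹ (q * r) := c1.mul_right c2
    refine quat_aux (i := p * q * a⁻¹) (j := q * r * a⁻¹) (n := n) ?_ ?_ ?_
      (h3m.trans hmn) (fun {x} h => (P.root h).2)
    · rw [mul_assoc, ← mul_assoc a⁻¹, cpq.eq, mul_assoc (p * q) a⁻¹, ← mul_assoc, e1]
      simp
    · rw [mul_assoc, ← mul_assoc a⁻¹, cqr.eq, mul_assoc (q * r) a⁻¹, ← mul_assoc, e2]
      simp
    · rw [mul_assoc, ← mul_assoc a⁻¹, cpq.eq, mul_assoc (p * q) a⁻¹, ← mul_assoc,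
        mul_assoc (p * q), ← mul_assoc a⁻¹, cqr.eq, mul_assoc (q * r) a⁻¹, ← mul_assoc (p * q)]
      rw [← neg_mul]
      congr 1
      have f1 : p * q * (q * r) = a * (p * r) := by
        rw [mul_assoc, ← mul_assoc q, s1, ← mul_assoc, ← mul_assoc]
        rw [(inv_inv a ▸ c0.inv_left : Commute a p).eq]
      have f2 : q * r * (p * q) = a * (r * p) := by
        have b2 : r * (p * q) = (p * q) * r := by
          rw [← mul_assoc, a02, neg_mul, mul_assoc, a12, mul_neg, neg_neg, mul_assoc]
        rw [mul_assoc, b2, ← mul_assoc, ← mul_assoc, a01, a02, mul_neg, ← f1]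
        simp only [neg_mul, mul_assoc]
      rw [f1, f2, a02, mul_neg]
  · have key : ∀ i, U i * U (i + 1) * U (i + 2) * U (i + 3) = 1 := by
      intro i
      have a01 := hanti i 1 n1
      have a12 := hanti (i + 1) 1 n1
      have a23 := hanti (i + 2) 1 n1
      have a02 := hanti i 2 n2
      have a13 := hanti (i + 1) 2 n2
      have a03 := hanti i 3 h3
      simp only [add_assoc] at a01 a12 a23 a02 a13 a03
      norm_num at a01 a12 a23 a02 a13 a03
      have hSP := P.mul (P.mul (P.mul (hS i) (hS (i + 1))) (hS (i + 2))) (hS (i + 3))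
      have hHP := H.mul_mem (H.mul_mem (H.mul_mem (hUH i) (hUH (i + 1))) (hUH (i + 2))) (hUH (i + 3))
      have haP := P.comm hHP haS hSP
      have s0 := hX2 i
      have s1 := hX2 (i + 1)
      have s2 := hX2 (i + 2)
      have s3 := hX2 (i + 3)
      have c0 := haX i
      have c1 := haX (i + 1)
      have c2 := haX (i + 2)
      have c3 := haX (i + 3)
      have hsq : (X i * X (i + 1) * X (i + 2) * X (i + 3)) ^ 2 = a ^ 4 := by
        generalize X i = p at *
        generalize X (i + 1) = q at *
        generalize X (i + 2) = r at *
        generalize X (i + 3) = t at *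
        have b1 : p * q * (p * q) = -(a * a) := by
          rw [mul_assoc, ← mul_assoc q, a01, neg_mul, mul_neg, mul_assoc p q q, s1, ← mul_assoc, s0]
        have b2 : r * (p * q) = (p * q) * r := by
          rw [← mul_assoc, a02, neg_mul, mul_assoc, a12, mul_neg, neg_neg, mul_assoc]
        have b3 : (p * q * r) * (p * q * r) = -(a * a * a) := by
          calc (p * q * r) * (p * q * r) = p * q * (r * (p * q)) * r := by group
            _ = (p * q) * (p * q) * (r * r) := by rw [b2]; group
            _ = _ := by rw [b1, s2, neg_mul]
        have b4 : t * (p * q * r) = -((p * q * r) * t) := by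
          rw [← mul_assoc, ← mul_assoc, a03, neg_mul, neg_mul, mul_assoc p t, a13, mul_neg, neg_mul,
            neg_neg, mul_assoc, mul_assoc, a23]
          simp only [mul_neg, mul_assoc]
        calc (p * q * r * t) ^ 2 = (p * q * r) * (t * (p * q * r)) * t := by rw [pow_two]; group
          _ = -((p * q * r) * (p * q * r) * (t * t)) := by rw [b4]; simp only [mul_neg, neg_mul, mul_assoc]
          _ = _ := by rw [b3, s3]; simp only [neg_mul, neg_neg, pow_succ, pow_zero, one_mul]
      have h5 : (X i * X (i + 1) * X (i + 2) * X (i + 3) * (a ^ 2)⁻¹) ^ 2 = 1 := by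
        rw [(haP.pow_left 2).inv_left.symm.mul_pow, hsq, inv_pow, ← pow_mul, mul_inv_cancel]
      have h6 := P.mul (P.pm h5) (P.pow haS 2)
      rw [inv_mul_cancel_right] at h6
      simpa using P.inj hSP h6
    have k0 := key 0
    have k1 := key 1
    norm_num at k0 k1
    apply n4
    apply hUd 0 4
    have c1 := hUc 0 1
    have c2 := hUc 0 2
    have c3 := hUc 0 3
    norm_num at c1 c2 c3 ⊢
    have : Commute (U 0) (U 1 * U 2 * U 3) := (c1.mul_right c2).mul_right c3
    have h7 : U 1 * U 2 * U 3 * U 0 = 1 := by rw [← this.eq, ← k0]; group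
    rw [← h7] at k1
    exact (mul_left_cancel k1).symm

theorem lemX [CharZero D] (P : PairSys S H n) {u y : G} (hu : u ∈ H) (hy : y ∈ H)
    (hc : ∀ i : ℕ, Commute u (y ^ i * u * (y ^ i)⁻¹)) : Commute u y := by
  have hc1 : Commute u (y * u * y⁻¹) := by simpa using hc 1
  rcases P.lemA hu hy hc1 with h | ⟨hn, hv⟩
  · exact h
  obtain ⟨m, hm⟩ : ∃ m, n = 2 * m := ⟨n / 2, by omega⟩
  have hmo : Odd m := Nat.odd_iff.mpr (by omega)
  have hsq : ∀ g : G, (g ^ m) ^ 2 = 1 := fun g => by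
    rw [← pow_mul, mul_comm, ← hm]; exact P.exp g
  have hcm : ∀ i : ℕ, Commute (u ^ m) (y ^ i * u ^ m * (y ^ i)⁻¹) := fun i => by
    rw [← conj_pow]; exact (hc i).pow_pow m m
  have ht : Commute (u ^ m) (y ^ m) := by
    have h1 := hcm m
    have hu2 := hsq u
    have ht2 := hsq y
    generalize u ^ m = a at *
    generalize y ^ m = t at *
    have h2 : (a * t) ^ 2 = a * (t * a * t⁻¹) := by
      have : t⁻¹ = t := by rw [inv_eq_iff_mul_eq_one, ← pow_two, ht2]
      rw [this, pow_two]; group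
    have h3 : ((a * t) ^ 2) ^ 2 = 1 := by
      rw [h2, h1.mul_pow, conj_pow, hu2]; group
    have h4 : ((a * t) ^ 2) ^ m = 1 := by rw [← pow_mul, ← hm]; exact P.exp _
    have h5 := odd_two_eq_one hmo h3 h4
    rw [h2] at h5
    have h6 : a⁻¹ = a := by rw [inv_eq_iff_mul_eq_one, ← pow_two, hu2]
    have h7 := eq_inv_of_mul_eq_one_right h5
    rw [h6, mul_inv_eq_iff_eq_mul] at h7
    exact h7.symm
  have hz : Commute (y ^ 2) (u ^ m) := by
    refine P.lemB (H.pow_mem hu m) (H.pow_mem hy 2) (hsq u) hmo ⟨2, by omega⟩ ?_ ?_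
    · rw [← pow_mul, ← hm]; exact P.exp y
    · intro i
      rw [← pow_mul]; exact hcm _
  have hy' : Commute (u ^ m) y := by
    obtain ⟨k, hk⟩ := hmo
    have : y = ((y ^ 2) ^ k)⁻¹ * y ^ m := by
      rw [hk, pow_succ y (2 * k), pow_mul, inv_mul_cancel_left]
    rw [this]
    exact (hz.symm.pow_right k).inv_right.mul_right ht
  have hvu : Commute (y * u * y⁻¹ * u⁻¹) u :=
    hc1.symm.mul_left (Commute.refl u).inv_left
  have h1 : (y * u * y⁻¹ * u⁻¹) ^ m = 1 := by
    have h2 : ((y * u * y⁻¹ * u⁻¹) * u) ^ m = u ^ m := by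
      rw [inv_mul_cancel_right, conj_pow, ← hy'.eq, mul_inv_cancel_right]
    rw [hvu.mul_pow] at h2
    exact mul_eq_right.mp h2
  have h2 := odd_two_eq_one hmo hv h1
  rw [mul_inv_eq_one, mul_inv_eq_iff_eq_mul] at h2
  exact h2.symm

end PairSys

theorem IsFaithfulGrading.unique {𝒜 : G → AddSubgroup D} (hG : IsFaithfulGrading 𝒜) {g h : G}
    {x : D} (hx : x ≠ 0) (h1 : x ∈ 𝒜 g) (h2 : x ∈ 𝒜 h) : g = h := by
  letI := hG.isInternal.chooseDecomposition
  exact DirectSum.degree_eq_of_mem_mem 𝒜 h1 h2 hx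

theorem IsFaithfulGrading.inv_mem {𝒜 : G → AddSubgroup D} (hG : IsFaithfulGrading 𝒜) {h : G}
    {x : D} (hx : x ≠ 0) (h1 : x ∈ 𝒜 h) : x⁻¹ ∈ 𝒜 h⁻¹ := by
  letI := hG.isInternal.chooseDecomposition
  have key : ∀ (y : D) (g : G), ((DirectSum.decompose 𝒜 (x * y) (h * g) : 𝒜 (h * g)) : D)
      = x * (DirectSum.decompose 𝒜 y g : 𝒜 g) := by
    intro y g
    induction y using DirectSum.Decomposition.inductionOn 𝒜 with
    | zero => simp
    | @homogeneous i m =>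
      have hm := hG.mul_mem h1 m.2
      by_cases hi : i = g
      · subst hi
        rw [DirectSum.decompose_of_mem_same 𝒜 hm, DirectSum.decompose_of_mem_same 𝒜 m.2]
      · rw [DirectSum.decompose_of_mem_ne 𝒜 hm (by simpa using hi),
          DirectSum.decompose_of_mem_ne 𝒜 m.2 hi, mul_zero]
    | add a b ha hb =>
      rw [mul_add, DirectSum.decompose_add, DirectSum.decompose_add, DirectSum.add_apply,
        DirectSum.add_apply, AddSubgroup.coe_add, AddSubgroup.coe_add, ha, hb, mul_add]
  have h0 : ∀ g, g ≠ h⁻¹ → ((DirectSum.decompose 𝒜 x⁻¹ g : 𝒜 g) : D) = 0 := by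
    intro g hg
    have h2 := key x⁻¹ g
    rw [mul_inv_cancel₀ hx, DirectSum.decompose_of_mem_ne 𝒜 hG.one_mem] at h2
    · exact (mul_eq_zero.mp h2.symm).resolve_left hx
    · intro h3
      exact hg (eq_inv_of_mul_eq_one_right h3.symm)
  classical
  rw [← DirectSum.sum_support_decompose 𝒜 x⁻¹]
  refine AddSubgroup.sum_mem _ fun g _ => ?_
  by_cases hg : g = h⁻¹
  · subst hg; exact SetLike.coe_mem _
  · rw [h0 g hg]; exact AddSubgroup.zero_mem _

/-- Homogeneous units of degree `h` commuting with the identity component. -/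
def homCen (𝒜 : G → AddSubgroup D) (h : G) (x : Dˣ) : Prop :=
  (x : D) ∈ 𝒜 h ∧ ∀ a ∈ 𝒜 1, (x : D) * a = a * x

theorem root_central {D : Type*} [DivisionRing D] {ζ : D} {n : ℕ} (hn : 0 < n)
    (hζK : ζ ∈ Subring.center D) (hζ : orderOf ζ = n) {z : D} (hz : z ^ n = 1) :
    ∃ k : ℕ, z = ζ ^ k := by
  set ζ' : Subring.center D := ⟨ζ, hζK⟩ with hζ'
  have ho : orderOf ζ' = n := by
    rw [← hζ]
    exact (orderOf_injective (Subring.center D).subtype.toMonoidHom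
      Subtype.val_injective ζ').symm
  have hprim : IsPrimitiveRoot ζ' n := ho ▸ IsPrimitiveRoot.orderOf ζ'
  have h1 := congrArg (Polynomial.aeval z) (Polynomial.X_pow_sub_one_eq_prod hn hprim)
  have h2 : (Polynomial.aeval z) (Polynomial.X ^ n - 1 : Polynomial (Subring.center D)) = 0 := by
    simp [hz]
  rw [h2] at h1
  have h3 : ∀ s : Finset (Subring.center D),
      (Polynomial.aeval z) (∏ η ∈ s, (Polynomial.X - Polynomial.C η)) = 0 →
      ∃ η ∈ s, z = (η : D) := by
    classical
    intro s
    induction s using Finset.induction_on with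
    | empty => simp
    | insert a s ha ih =>
      intro h
      rw [Finset.prod_insert ha, map_mul] at h
      rcases mul_eq_zero.mp h with h | h
      · refine ⟨a, by simp, ?_⟩
        rw [map_sub, Polynomial.aeval_X, Polynomial.aeval_C, sub_eq_zero] at h
        exact h
      · obtain ⟨η, h4, h5⟩ := ih h
        exact ⟨η, by simp [h4], h5⟩
  obtain ⟨η, h4, h5⟩ := h3 _ h1.symm
  rw [Polynomial.mem_nthRootsFinset hn] at h4
  have : NeZero n := ⟨hn.ne'⟩
  obtain ⟨k, _, hk⟩ := hprim.eq_pow_of_pow_eq_one h4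
  exact ⟨k, by rw [h5, ← hk]; rfl⟩

theorem homCen_conj {𝒜 : G → AddSubgroup D} (hG : IsFaithfulGrading 𝒜) {g h : G} {d x : Dˣ}
    (hd : (d : D) ∈ 𝒜 g) (hx : homCen 𝒜 h x) : homCen 𝒜 (g * h * g⁻¹) (d * x * d⁻¹) := by
  have hdi : ((d⁻¹ : Dˣ) : D) ∈ 𝒜 g⁻¹ := by
    rw [Units.val_inv_eq_inv_val]; exact hG.inv_mem d.ne_zero hd
  refine ⟨?_, fun a ha => ?_⟩
  · exact hG.mul_mem (hG.mul_mem hd hx.1) hdi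
  · have hb : ((d⁻¹ : Dˣ) : D) * a * d ∈ 𝒜 1 := by
      have := hG.mul_mem (hG.mul_mem hdi ha) hd
      simpa using this
    have h1 := hx.2 _ hb
    have e : a = d * (((d⁻¹ : Dˣ) : D) * a * d) * ((d⁻¹ : Dˣ) : D) := by simp [mul_assoc]
    generalize ((d⁻¹ : Dˣ) : D) * a * d = b at *
    rw [e]
    simp only [Units.val_mul, mul_assoc, Units.inv_mul_cancel_left]
    rw [← mul_assoc (x : D), h1, mul_assoc]

theorem homCen_sys [Finite G] {𝒜 : G → AddSubgroup D} (hG : IsFaithfulGrading 𝒜)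
    {ζ : D} (hζK : ζ ∈ Subring.center D) (hζe : ζ ∈ 𝒜 1)
    (hζ : orderOf ζ = Monoid.exponent G)
    {H : Subgroup G} (hHcar : (H : Set G) = Hset 𝒜)
    (hrep : ∀ h ∈ H, ∃ x : D, x ≠ 0 ∧ x ∈ 𝒜 h ∧ ∀ a ∈ 𝒜 1, x * a = a * x) :
    PairSys (homCen 𝒜) H (Monoid.exponent G) where
  one := ⟨hG.one_mem, fun a _ => by simp⟩
  mul := fun {g h x y} hx hy => ⟨hG.mul_mem hx.1 hy.1, fun a ha => by
    rw [Units.val_mul, mul_assoc, hy.2 a ha, ← mul_assoc, hx.2 a ha, mul_assoc]⟩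
  inv := fun {g x} hx => ⟨by
    rw [Units.val_inv_eq_inv_val]; exact hG.inv_mem x.ne_zero hx.1, fun a ha => by
    have : Commute (x : D) a := hx.2 a ha
    exact this.units_inv_left.eq⟩
  inj := fun {g h x} h1 h2 => hG.unique x.ne_zero h1.1 h2.1
  neg := ⟨by
    rw [Units.val_neg, Units.val_one]; exact (𝒜 1).neg_mem hG.one_mem, fun a _ => by simp⟩
  comm := fun {h l x} hh hl hx => by
    have h1 : h ∈ Hset 𝒜 := by rw [← hHcar]; exact hh
    have h2 := h1 x hx.1 l ⟨hl.1, hl.2⟩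
    exact Units.ext h2.symm
  ex := fun {h} hh => by
    obtain ⟨x, h0, h1, h2⟩ := hrep h hh
    exact ⟨Units.mk0 x h0, h1, h2⟩
  root := fun {x} hx => by
    have hx' : (x : D) ^ Monoid.exponent G = 1 := by
      rw [← Units.val_pow_eq_pow_val, hx, Units.val_one]
    obtain ⟨k, hk⟩ := root_central (Nat.pos_of_ne_zero Monoid.exponent_ne_zero_of_finite) hζK hζ hx'
    have hcen : (x : D) ∈ Subring.center D := by rw [hk]; exact Subring.pow_mem _ hζK k
    have hc : ∀ y : D, (x : D) * y = y * x := fun y => (Subring.mem_center_iff.mp hcen y).symm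
    have hmem : (x : D) ∈ 𝒜 1 := by
      rw [hk]
      clear hk
      induction k with
      | zero => simpa using hG.one_mem
      | succ k ih => 
        rw [pow_succ]
        simpa using hG.mul_mem ih hζe
    exact ⟨⟨hmem, fun a _ => hc a⟩, fun y => Units.ext (hc y)⟩
  exp := fun g => Monoid.pow_exponent_eq_one g

namespace PairSys

variable {G D : Type*} [Group G] [DivisionRing D] {S : G → Dˣ → Prop} {H : Subgroup G} {n : ℕ}

theorem abelian [CharZero D] [Finite G] (P : PairSys S H n) {a b : G} (ha : a ∈ H) (hb : b ∈ H) :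
    Commute a b := by
  have := ab_of_X (Nat.card H) (H := H) rfl (fun u y h => by
    refine Subtype.ext (P.lemX u.2 y.2 fun i => ?_).eq
    have := congrArg Subtype.val (h i).eq
    simpa [Commute, SemiconjBy] using this) ⟨a, ha⟩ ⟨b, hb⟩
  exact congrArg Subtype.val this.eq

theorem one_comm [CharZero D] [Finite G] (P : PairSys S H n) {h k : G} {x y : Dˣ}
    (hh : h ∈ H) (hk : k ∈ H) (hx : S h x) (hy : S k y) : S 1 (x * y * x⁻¹ * y⁻¹) := by
  have := P.mul (P.mul (P.mul hx hy) (P.inv hx)) (P.inv hy)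
  convert this using 1
  rw [(P.abelian hh hk).eq]; group

theorem comm_pow [CharZero D] [Finite G] (P : PairSys S H n) {h k : G} {x y : Dˣ} {e : ℕ}
    (hh : h ∈ H) (hk : k ∈ H) (hx : S h x) (hy : S k y) (he : h ^ e = 1) :
    (x * y * x⁻¹ * y⁻¹) ^ e = 1 := by
  have h1 := P.one_comm hh hk hx hy
  have h2 := P.comm hh h1 hx
  have hxe : S 1 (x ^ e) := by rw [← he]; exact P.pow hx e
  have h3 := pow_swap (x := x) (c := y) (w := x * y * x⁻¹ * y⁻¹) (by group) h2 e
  rw [(P.comm hk hxe hy).eq] at h3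
  exact mul_eq_right.mp (mul_right_cancel h3).symm

theorem comm_indep (P : PairSys S H n) {h k : G} {x y x' y' : Dˣ}
    (hh : h ∈ H) (hk : k ∈ H) (hx : S h x) (hy : S k y) (hx' : S h x') (hy' : S k y') :
    x' * y' * x'⁻¹ * y'⁻¹ = x * y * x⁻¹ * y⁻¹ := by
  obtain ⟨l, hl⟩ : ∃ l, l = x' * x⁻¹ := ⟨_, rfl⟩
  obtain ⟨r, hr⟩ : ∃ r, r = y' * y⁻¹ := ⟨_, rfl⟩
  have hlS : S 1 l := by rw [hl, ← mul_inv_cancel h]; exact P.mul hx' (P.inv hx)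
  have hrS : S 1 r := by rw [hr, ← mul_inv_cancel k]; exact P.mul hy' (P.inv hy)
  have ex : x' = l * x := by rw [hl]; group
  have ey : y' = r * y := by rw [hr]; group
  have c1 : l * y' = y' * l := (P.comm hk hlS hy').eq
  have c2 : r * x = x * r := (P.comm hh hrS hx).eq
  have c3 : l * x = x * l := (P.comm hh hlS hx).eq
  calc x' * y' * x'⁻¹ * y'⁻¹ = x * (l * y') * l⁻¹ * x⁻¹ * y'⁻¹ := by rw [ex, c3]; group
    _ = x * y' * x⁻¹ * y'⁻¹ := by rw [c1]; group
    _ = x * r * y * x⁻¹ * y⁻¹ * r⁻¹ := by rw [ey]; group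
    _ = r * (x * y * x⁻¹ * y⁻¹) * r⁻¹ := by rw [← c2]; group
    _ = _ := by
      have d1 := P.comm hh hrS hx
      have d2 := P.comm hk hrS hy
      have d3 : Commute r (x * y * x⁻¹ * y⁻¹) :=
        ((d1.mul_right d2).mul_right d1.inv_right).mul_right d2.inv_right
      rw [d3.eq, mul_inv_cancel_right]

end PairSys

/-- Under the standing hypotheses, for `h, h' ∈ H` and nonzero
`x ∈ D_h`, `y ∈ D_{h'}` commuting with every element of `D_e`, the commutator
`c = x y x⁻¹ y⁻¹` lies in `L` and satisfies `c ^ n_H = 1`; it depends only on `(h, h')`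
and not on the choices of `x` and `y`; and it is `G`-invariant. -/
theorem commutator_pairing_well_defined
    [Finite G] [CharZero D]
    (𝒜 : G → AddSubgroup D) (hG : IsFaithfulGrading 𝒜)
    [Module.Finite ↥(Subring.center D) D]
    (ζ : D) (hζK : ζ ∈ Subring.center D) (hζe : ζ ∈ 𝒜 1)
    (hζ : orderOf ζ = Monoid.exponent G)
    (H : Subgroup G) (hHcar : (H : Set G) = Hset 𝒜) (hHn : H.Normal)
    (hrep : ∀ h ∈ H, ∃ x : D, x ≠ 0 ∧ x ∈ 𝒜 h ∧ ∀ a ∈ 𝒜 1, x * a = a * x) :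
    ∀ h ∈ H, ∀ h' ∈ H,
      ∀ x : D, x ∈ 𝒜 h → x ≠ 0 → (∀ a ∈ 𝒜 1, x * a = a * x) →
      ∀ y : D, y ∈ 𝒜 h' → y ≠ 0 → (∀ a ∈ 𝒜 1, y * a = a * y) →
      -- `c` lies in `L` and `c ^ n_H = 1`
      (x * y * x⁻¹ * y⁻¹ ∈ Lset 𝒜 ∧ (x * y * x⁻¹ * y⁻¹) ^ Monoid.exponent ↥H = 1) ∧
      -- `c` depends only on the pair `(h, h')`, not on the choices of `x` and `y`
      (∀ x' : D, x' ∈ 𝒜 h → x' ≠ 0 → (∀ a ∈ 𝒜 1, x' * a = a * x') →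
        ∀ y' : D, y' ∈ 𝒜 h' → y' ≠ 0 → (∀ a ∈ 𝒜 1, y' * a = a * y') →
        x' * y' * x'⁻¹ * y'⁻¹ = x * y * x⁻¹ * y⁻¹) ∧
      -- `c` is `G`-invariant
      (∀ g : G,
        ∀ x' : D, x' ∈ 𝒜 (g * h * g⁻¹) → x' ≠ 0 → (∀ a ∈ 𝒜 1, x' * a = a * x') →
        ∀ y' : D, y' ∈ 𝒜 (g * h' * g⁻¹) → y' ≠ 0 → (∀ a ∈ 𝒜 1, y' * a = a * y') →
        x' * y' * x'⁻¹ * y'⁻¹ = x * y * x⁻¹ * y⁻¹) := by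
  intro h hh h' hh' x hx hx0 hxc y hy hy0 hyc
  have P := homCen_sys hG hζK hζe hζ hHcar hrep
  have hX : homCen 𝒜 h (Units.mk0 x hx0) := ⟨hx, hxc⟩
  have hY : homCen 𝒜 h' (Units.mk0 y hy0) := ⟨hy, hyc⟩
  have hL := P.one_comm hh hh' hX hY
  have hpow : ∀ e : ℕ, h ^ e = 1 → (x * y * x⁻¹ * y⁻¹) ^ e = 1 := by
    intro e he
    have := congrArg Units.val (P.comm_pow hh hh' hX hY he)
    simpa using this
  refine ⟨⟨⟨by simpa using hL.1, by simpa using hL.2⟩, hpow _ ?_⟩, ?_, ?_⟩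
  · have := Monoid.pow_exponent_eq_one (⟨h, hh⟩ : H)
    simpa using congrArg Subtype.val this
  · intro x' hx' hxz hxcc y' hy' hyz hycc
    have hX' : homCen 𝒜 h (Units.mk0 x' hxz) := ⟨hx', hxcc⟩
    have hY' : homCen 𝒜 h' (Units.mk0 y' hyz) := ⟨hy', hycc⟩
    have := congrArg Units.val (P.comm_indep hh hh' hX hY hX' hY')
    simpa using this
  · intro g x' hx' hxz hxcc y' hy' hyz hycc
    have hX' : homCen 𝒜 (g * h * g⁻¹) (Units.mk0 x' hxz) := ⟨hx', hxcc⟩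
    have hY' : homCen 𝒜 (g * h' * g⁻¹) (Units.mk0 y' hyz) := ⟨hy', hycc⟩
    obtain ⟨d, hd, hd0⟩ := ((𝒜 g).ne_bot_iff_exists_ne_zero.mp (hG.faithful g) :
      ∃ d : 𝒜 g, d ≠ 0) |> fun ⟨d, hd⟩ => (⟨d.1, d.2, fun h0 => hd (Subtype.ext h0)⟩ :
        ∃ d : D, d ∈ 𝒜 g ∧ d ≠ 0)
    have hdm : ((Units.mk0 d hd0 : Dˣ) : D) ∈ 𝒜 g := hd
    have h1 := P.comm_indep (hHn.conj_mem h hh g) (hHn.conj_mem h' hh' g)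
      (homCen_conj hG hdm hX) (homCen_conj hG hdm hY) hX' hY'
    have hcen := (P.root (P.comm_pow hh hh' hX hY (P.exp h))).2 (Units.mk0 d hd0)
    generalize Units.mk0 d hd0 = d' at *
    have h2 : d' * Units.mk0 x hx0 * d'⁻¹ * (d' * Units.mk0 y hy0 * d'⁻¹)
        * (d' * Units.mk0 x hx0 * d'⁻¹)⁻¹ * (d' * Units.mk0 y hy0 * d'⁻¹)⁻¹
        = d' * (Units.mk0 x hx0 * Units.mk0 y hy0 * (Units.mk0 x hx0)⁻¹ * (Units.mk0 y hy0)⁻¹)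
          * d'⁻¹ := by group
    rw [h2, ← hcen.eq, mul_inv_cancel_right] at h1
    simpa using congrArg Units.val h1
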